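/- Let k > 0 and C_T = {τ ∈ M³ˣ³_sym : λ₁(τ) − λ₃(τ) ≤ 2k}. Let σ ∈ M³ˣ³_sym with λ₁(σ) = λ₂(σ) > λ₃(σ) and λ₁(σ) − λ₃(σ) = 2k, and let v₃ be a unit eigenvector of σ for λ₃(σ). Let G₃(σ) = {τ ∈ M³ˣ³_sym : τv₃ = 0}, a linear subspace of M³ˣ³_sym, and let P_{G₃(σ)} be the orthogonal projection onto G₃(σ). For τ ∈ M³ˣ³_sym set B = P_{G₃(σ)}(dev τ), S₃(σ;τ) = B − λ₃(B)·I, and ρ₃(σ;τ) = max(¼ + ¾·(λ₁(B)+λ₂(B)+λ₃(B))/(|λ₁(B)|+|λ₂(B)|+|λ₃(B)|), 0) if B ≠ 0, with ρ₃(σ;τ) = 0 if B = 0. Then for every τ ∈ M³ˣ³_sym: P_{N_{C_T}(σ)}(τ) = ρ₃(σ;τ) · [S₃(σ;τ) − tr(S₃(σ;τ))·v₃v₃ᵀ]. -/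

import Mathlib

open Matrix

/-- The space of 3×3 real matrices (we single out the symmetric ones by `Matrix.IsSymm`). -/
abbrev Mat3 := Matrix (Fin 3) (Fin 3) ℝ

/-- The Frobenius inner product on symmetric matrices: `σ:τ = tr(στ)`. -/
noncomputable def minner (A B : Mat3) : ℝ := (A * B).trace

/-- The Frobenius norm `‖A‖ = (A:A)^{1/2}` on symmetric matrices. -/
noncomputable def mnorm (A : Mat3) : ℝ := Real.sqrt (minner A A)

/-- `p` is the metric (orthogonal) projection of `z` onto `K`. -/
def IsProjOn (K : Set Mat3) (z p : Mat3) : Prop :=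
  p ∈ K ∧ ∀ w ∈ K, mnorm (z - p) ≤ mnorm (z - w)

/-- The tangent cone of a convex set `C` at `σ`. -/
def tangentCone (C : Set Mat3) (σ : Mat3) : Set Mat3 :=
  closure {τ | ∃ η ∈ C, ∃ α : ℝ, 0 < α ∧ τ = α • (η - σ)}

/-- The normal cone of a convex set `C ⊆ M³ˣ³_sym` at `σ`. -/
def normalCone (C : Set Mat3) (σ : Mat3) : Set Mat3 :=
  {n | n.IsSymm ∧ ∀ τ ∈ tangentCone C σ, minner n τ ≤ 0}

/-- The Hooke (isotropic elasticity) operator `H(τ) = 2μτ + λ tr(τ) I`. -/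
noncomputable def hooke (lam mu : ℝ) (τ : Mat3) : Mat3 :=
  (2 * mu) • τ + (lam * τ.trace) • (1 : Mat3)

/-- The set of (real) eigenvalues of `A`, i.e. the real roots of `det(A - t I) = 0`. -/
def eigSet (A : Mat3) : Set ℝ := {t : ℝ | (A - t • (1 : Mat3)).det = 0}

/-- The largest eigenvalue `λ₁(A)` of `A`. -/
noncomputable def lam1 (A : Mat3) : ℝ := sSup (eigSet A)

/-- The smallest eigenvalue `λ₃(A)` of `A`. -/
noncomputable def lam3 (A : Mat3) : ℝ := sInf (eigSet A)

/-- The middle eigenvalue `λ₂(A)` of `A` (recovered from the trace). -/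
noncomputable def lam2 (A : Mat3) : ℝ := A.trace - lam1 A - lam3 A

/-- The deviatoric part of a matrix: `dev τ = τ - (tr τ / 3) I`. -/
noncomputable def dev (τ : Mat3) : Mat3 := τ - (τ.trace / 3) • (1 : Mat3)


theorem aux_frame (v : Fin 3 → ℝ) (hv : v ⬝ᵥ v = 1) :
    ∃ Q : Mat3, Qᵀ * Q = 1 ∧ ∀ i, Q i 2 = v i := by
  have hv' : v 0 * v 0 + v 1 * v 1 + v 2 * v 2 = 1 := by
    simpa [dotProduct, Fin.sum_univ_three] using hv
  obtain ⟨a, b, c, h1, h2⟩ : ∃ a b c : ℝ, a * a + b * b + c * c = 1 ∧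
      a * v 0 + b * v 1 + c * v 2 = 0 := by
    by_cases h : v 0 * v 0 + v 1 * v 1 = 0
    · have h0 : v 0 = 0 := by nlinarith [mul_self_nonneg (v 0), mul_self_nonneg (v 1)]
      exact ⟨1, 0, 0, by norm_num, by simp [h0]⟩
    · have hp : 0 < v 0 * v 0 + v 1 * v 1 :=
        lt_of_le_of_ne (add_nonneg (mul_self_nonneg _) (mul_self_nonneg _)) (Ne.symm h)
      have hs := Real.mul_self_sqrt hp.le
      have hs0 : Real.sqrt (v 0 * v 0 + v 1 * v 1) ≠ 0 := (Real.sqrt_pos.2 hp).ne'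
      set r := Real.sqrt (v 0 * v 0 + v 1 * v 1)
      refine ⟨-v 1 / r, v 0 / r, 0, ?_, ?_⟩
      · field_simp
        nlinarith
      · field_simp
        ring
  refine ⟨!![a, v 1 * c - v 2 * b, v 0; b, v 2 * a - v 0 * c, v 1; c, v 0 * b - v 1 * a, v 2],
    ?_, ?_⟩
  · have h3 : (v 1 * c - v 2 * b) ^ 2 + (v 2 * a - v 0 * c) ^ 2 + (v 0 * b - v 1 * a) ^ 2 = 1 := by
      have : (v 1 * c - v 2 * b) ^ 2 + (v 2 * a - v 0 * c) ^ 2 + (v 0 * b - v 1 * a) ^ 2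
        = (a * a + b * b + c * c) * (v 0 * v 0 + v 1 * v 1 + v 2 * v 2)
          - (a * v 0 + b * v 1 + c * v 2) ^ 2 := by ring
      rw [this, h1, h2, hv']; norm_num
    ext i j
    fin_cases i <;> fin_cases j <;>
      simp [Matrix.mul_apply, Fin.sum_univ_three] <;> linarith
  · intro i
    fin_cases i <;> simp

theorem aux_rot (a b c : ℝ) : ∃ x y : ℝ, x * x + y * y = 1 ∧
    b * (x * x - y * y) - (a - c) * (x * y) = 0 ∧
    0 ≤ (a - c) * (x * x - y * y) + 4 * b * (x * y) := by
  set z : ℂ := ⟨(a - c) / 2, b⟩ with hz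
  have hre : ‖z‖ * Real.cos (Complex.arg z) = (a - c) / 2 := Complex.norm_mul_cos_arg z
  have him : ‖z‖ * Real.sin (Complex.arg z) = b := Complex.norm_mul_sin_arg z
  have e : Complex.arg z = 2 * (Complex.arg z / 2) := by ring
  have hc : Real.cos (Complex.arg z) = Real.cos (Complex.arg z / 2) * Real.cos (Complex.arg z / 2) -
     Real.sin (Complex.arg z / 2) * Real.sin (Complex.arg z / 2) := by
    conv_lhs => rw [e, Real.cos_two_mul']
    ring
  have hs : Real.sin (Complex.arg z) =
      2 * (Real.cos (Complex.arg z / 2) * Real.sin (Complex.arg z / 2)) := by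
    conv_lhs => rw [e, Real.sin_two_mul]
    ring
  have h1 := Real.cos_sq_add_sin_sq (Complex.arg z)
  have hn := norm_nonneg z
  refine ⟨Real.cos (Complex.arg z / 2), Real.sin (Complex.arg z / 2), ?_, ?_, ?_⟩
  · nlinarith [Real.cos_sq_add_sin_sq (Complex.arg z / 2)]
  · rw [← hc]
    have : Real.cos (Complex.arg z / 2) * Real.sin (Complex.arg z / 2)
      = Real.sin (Complex.arg z) / 2 := by linarith
    rw [this]
    have : a - c = 2 * (‖z‖ * Real.cos (Complex.arg z)) := by linarith
    rw [this, ← him]; ring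
  · rw [← hc]
    have : Real.cos (Complex.arg z / 2) * Real.sin (Complex.arg z / 2)
      = Real.sin (Complex.arg z) / 2 := by linarith
    rw [this]
    have : a - c = 2 * (‖z‖ * Real.cos (Complex.arg z)) := by linarith
    rw [this, ← him]
    have : 2 * (‖z‖ * Real.cos z.arg) * Real.cos z.arg +
      4 * (‖z‖ * Real.sin z.arg) * (Real.sin z.arg / 2) = 2 * ‖z‖ := by linear_combination 2 * ‖z‖ * h1
    linarith

theorem aux_conj (Q A : Mat3) (hQ : Qᵀ * Q = 1) : Q * (Qᵀ * A * Q) * Qᵀ = A := by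
  have h' : Q * Qᵀ = 1 := mul_eq_one_comm.1 hQ
  calc Q * (Qᵀ * A * Q) * Qᵀ = (Q * Qᵀ) * A * (Q * Qᵀ) := by simp only [Matrix.mul_assoc]
    _ = A := by rw [h']; simp

theorem aux_spec (A : Mat3) (hA : A.IsSymm) (v : Fin 3 → ℝ) (hv : v ⬝ᵥ v = 1) (μ : ℝ)
    (hAv : A *ᵥ v = μ • v) :
    ∃ Q : Mat3, Qᵀ * Q = 1 ∧ (∀ i, Q i 2 = v i) ∧ ∃ d e : ℝ, e ≤ d ∧
      A = Q * diagonal ![d, e, μ] * Qᵀ := by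
  obtain ⟨R, hR, hRv⟩ := aux_frame v hv
  set M := Rᵀ * A * R with hM
  have hMs : Mᵀ = M := by
    rw [hM, transpose_mul, transpose_mul, hA.eq, transpose_transpose, Matrix.mul_assoc]
  have hM3 : ∀ i, M i 2 = μ * (1 : Mat3) i 2 := by
    intro i
    have h1 : ∀ j, (A * R) j 2 = μ * R j 2 := by
      intro j
      have := congrFun hAv j
      simp only [mulVec, dotProduct, Pi.smul_apply, smul_eq_mul] at this
      rw [Matrix.mul_apply, hRv j, ← this]
      simp [hRv]
    rw [hM, Matrix.mul_assoc, Matrix.mul_apply, ← hR, Matrix.mul_apply, Finset.mul_sum]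
    refine Finset.sum_congr rfl fun j _ => ?_
    rw [h1]; ring
  have h02 : M 0 2 = 0 := by rw [hM3]; simp
  have h12 : M 1 2 = 0 := by rw [hM3]; simp
  have h22 : M 2 2 = μ := by rw [hM3]; simp
  have h20 : M 2 0 = 0 := by rw [← h02]; exact congrFun (congrFun hMs.symm 2) 0
  have h21 : M 2 1 = 0 := by rw [← h12]; exact congrFun (congrFun hMs.symm 2) 1
  have h10 : M 1 0 = M 0 1 := congrFun (congrFun hMs.symm 1) 0
  obtain ⟨x, y, hxy, ho, hd⟩ := aux_rot (M 0 0) (M 0 1) (M 1 1)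
  set T : Mat3 := !![x, -y, 0; y, x, 0; 0, 0, 1] with hT
  have hTT : Tᵀ * T = 1 := by
    ext i j
    fin_cases i <;> fin_cases j <;>
      simp [hT, Matrix.mul_apply, Fin.sum_univ_three] <;> linarith
  have hTM : Tᵀ * M * T = diagonal ![M 0 0 * (x * x) + 2 * M 0 1 * (x * y) + M 1 1 * (y * y),
      M 0 0 * (y * y) - 2 * M 0 1 * (x * y) + M 1 1 * (x * x), μ] := by
    ext i j
    fin_cases i <;> fin_cases j <;>
      simp [hT, Matrix.mul_apply, Fin.sum_univ_three, h02, h12, h22, h20, h21, h10] <;> linarith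
  refine ⟨R * T, ?_, ?_, M 0 0 * (x * x) + 2 * M 0 1 * (x * y) + M 1 1 * (y * y),
      M 0 0 * (y * y) - 2 * M 0 1 * (x * y) + M 1 1 * (x * x), ?_, ?_⟩
  · rw [transpose_mul]
    calc Tᵀ * Rᵀ * (R * T) = Tᵀ * (Rᵀ * R) * T := by simp only [Matrix.mul_assoc]
      _ = 1 := by rw [hR, Matrix.mul_one, hTT]
  · intro i
    simp [Matrix.mul_apply, Fin.sum_univ_three, hT, hRv]
  · linarith
  · rw [← hTM, transpose_mul]
    calc A = R * M * Rᵀ := (aux_conj R A hR).symm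
      _ = R * (T * (Tᵀ * M * T) * Tᵀ) * Rᵀ := by rw [aux_conj T M hTT]
      _ = _ := by simp only [Matrix.mul_assoc]

theorem aux_eigSet (Q : Mat3) (hQ : Qᵀ * Q = 1) (d e f : ℝ) :
    eigSet (Q * diagonal ![d, e, f] * Qᵀ) = {d, e, f} := by
  have h' : Q * Qᵀ = 1 := mul_eq_one_comm.1 hQ
  ext t
  have : Q * diagonal ![d, e, f] * Qᵀ - t • (1 : Mat3)
      = Q * diagonal ![d - t, e - t, f - t] * Qᵀ := by
    have h2 : diagonal ![d - t, e - t, f - t] = diagonal ![d, e, f] - t • (1 : Mat3) := by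
      ext i j
      fin_cases i <;> fin_cases j <;> simp
    rw [h2, Matrix.mul_sub, Matrix.sub_mul]
    simp [h']
  have hdet : Q.det * Q.det = 1 := by
    have := congrArg det h'
    simpa using this
  have hq : Q.det ≠ 0 := by
    intro h; simp [h] at hdet
  simp only [eigSet, Set.mem_ofPred_eq, this, det_mul, det_transpose, det_diagonal,
    Fin.prod_univ_three, Set.mem_insert_iff, Set.mem_singleton_iff]
  simp [hq, sub_eq_zero, or_assoc, eq_comm]

theorem aux_lam (Q : Mat3) (hQ : Qᵀ * Q = 1) (d e f : ℝ) :
    lam1 (Q * diagonal ![d, e, f] * Qᵀ) = max d (max e f) ∧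
    lam3 (Q * diagonal ![d, e, f] * Qᵀ) = min d (min e f) ∧
    (Q * diagonal ![d, e, f] * Qᵀ).trace = d + e + f := by
  refine ⟨?_, ?_, ?_⟩
  · rw [lam1, aux_eigSet Q hQ]
    rw [csSup_insert (Set.Finite.bddAbove (by simp)) (by simp), csSup_pair]
  · rw [lam3, aux_eigSet Q hQ]
    rw [csInf_insert (Set.Finite.bddBelow (by simp)) (by simp), csInf_pair]
  · rw [trace_mul_comm, ← Matrix.mul_assoc, hQ, Matrix.one_mul, trace_diagonal]
    simp [Fin.sum_univ_three]

/-- Every symmetric matrix has an orthogonal diagonalisation. -/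
theorem aux_spec' (A : Mat3) (hA : A.IsSymm) :
    ∃ Q : Mat3, Qᵀ * Q = 1 ∧ ∃ d e f : ℝ, A = Q * diagonal ![d, e, f] * Qᵀ := by
  have hH : A.IsHermitian := by
    rw [Matrix.IsHermitian, conjTranspose_eq_transpose_of_trivial]; exact hA
  set v : Fin 3 → ℝ := ⇑(hH.eigenvectorBasis 0) with hv
  refine (aux_spec A hA v ?_ (hH.eigenvalues 0) (hH.mulVec_eigenvectorBasis 0)).elim ?_
  · have := (hH.eigenvectorBasis).orthonormal.1 0
    have h2 : inner ℝ (hH.eigenvectorBasis 0) (hH.eigenvectorBasis 0) = (1 : ℝ) := by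
      rw [real_inner_self_eq_norm_sq, this]; norm_num
    rw [EuclideanSpace.inner_eq_star_dotProduct] at h2
    simpa only [star_trivial, hv] using h2
  · rintro Q ⟨h1, -, d, e, -, h⟩
    exact ⟨Q, h1, d, e, _, h⟩

theorem aux_bounds (A : Mat3) (hA : A.IsSymm) (Q : Mat3) (hQ : Qᵀ * Q = 1) (i : Fin 3) :
    lam3 A ≤ (Qᵀ * A * Q) i i ∧ (Qᵀ * A * Q) i i ≤ lam1 A := by
  obtain ⟨R, hR, d, e, f, rfl⟩ := aux_spec' A hA
  obtain ⟨h1, h3, -⟩ := aux_lam R hR d e f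
  rw [h1, h3]
  set X := Rᵀ * Q with hX
  have hXX : Xᵀ * X = 1 := by
    have h' : R * Rᵀ = 1 := mul_eq_one_comm.1 hR
    calc Xᵀ * X = Qᵀ * (R * Rᵀ) * Q := by
          rw [hX, transpose_mul, transpose_transpose]; simp only [Matrix.mul_assoc]
      _ = 1 := by rw [h', Matrix.mul_one, hQ]
  have e1 : Qᵀ * (R * diagonal ![d, e, f] * Rᵀ) * Q = Xᵀ * diagonal ![d, e, f] * X := by
    rw [hX, transpose_mul, transpose_transpose]; simp only [Matrix.mul_assoc]
  rw [e1]
  have h := congrFun (congrFun hXX i) i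
  simp only [Matrix.mul_apply, Fin.sum_univ_three, transpose_apply, one_apply_eq] at h
  have e2 : (Xᵀ * diagonal ![d, e, f] * X) i i
      = d * (X 0 i * X 0 i) + e * (X 1 i * X 1 i) + f * (X 2 i * X 2 i) := by
    simp [Matrix.mul_apply, Fin.sum_univ_three, diagonal_apply]; ring
  rw [e2]
  have p0 := mul_self_nonneg (X 0 i)
  have p1 := mul_self_nonneg (X 1 i)
  have p2 := mul_self_nonneg (X 2 i)
  constructor
  · set m := min d (min e f) with hm
    have a1 : m ≤ d := min_le_left _ _
    have a2 : m ≤ e := (min_le_right _ _).trans (min_le_left _ _)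
    have a3 : m ≤ f := (min_le_right _ _).trans (min_le_right _ _)
    have hmm := congrArg (m * ·) h
    simp only [mul_one, mul_add] at hmm
    nlinarith [mul_nonneg (sub_nonneg.2 a1) p0, mul_nonneg (sub_nonneg.2 a2) p1,
      mul_nonneg (sub_nonneg.2 a3) p2]
  · set m := max d (max e f) with hm
    have a1 : d ≤ m := le_max_left _ _
    have a2 : e ≤ m := (le_max_left _ _).trans (le_max_right _ _)
    have a3 : f ≤ m := (le_max_right _ _).trans (le_max_right _ _)
    have hmm := congrArg (m * ·) h
    simp only [mul_one, mul_add] at hmm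
    nlinarith [mul_nonneg (sub_nonneg.2 a1) p0, mul_nonneg (sub_nonneg.2 a2) p1,
      mul_nonneg (sub_nonneg.2 a3) p2]

theorem aux_minner_conj (Q A M : Mat3) : minner A (Q * M * Qᵀ) = minner (Qᵀ * A * Q) M := by
  rw [minner, minner, trace_mul_comm (Qᵀ * A * Q) M, trace_mul_comm A]
  rw [Matrix.mul_assoc Q M, Matrix.mul_assoc Q, trace_mul_comm Q]
  simp only [Matrix.mul_assoc]

theorem aux_minner_comm (A B : Mat3) : minner A B = minner B A := trace_mul_comm _ _

/-- scalar part -/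
theorem aux_scalar (b c ρ m : ℝ) (hbc : c ≤ b) (hm : m = min b (min c 0))
    (h0 : b = 0 → c = 0 → ρ = 0)
    (h1 : ¬ (b = 0 ∧ c = 0) → ρ = max (1 / 4 + 3 / 4 *
      ((b + c) / (|max b (max c 0)| + |b + c - max b (max c 0) - m| + |m|))) 0) :
    0 ≤ ρ * (b - m) ∧ 0 ≤ ρ * (c - m) ∧
    2 * b + c - 2 * (ρ * (b - m)) - ρ * (c - m) ≤ 0 ∧
    b + 2 * c - ρ * (b - m) - 2 * (ρ * (c - m)) ≤ 0 ∧
    (2 * b + c - 2 * (ρ * (b - m)) - ρ * (c - m)) * (ρ * (b - m)) = 0 ∧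
    (b + 2 * c - ρ * (b - m) - 2 * (ρ * (c - m))) * (ρ * (c - m)) = 0 := by
  by_cases hz : b = 0 ∧ c = 0
  · obtain ⟨rfl, rfl⟩ := hz
    simp [h0 rfl rfl]
  replace h1 := h1 hz
  rcases le_or_gt 0 c with hc | hc
  · have hb : 0 ≤ b := hc.trans hbc
    have hm0 : m = 0 := by rw [hm, min_eq_right hc, min_eq_right hb]
    have hne : 0 < b + c := by
      rcases hb.lt_or_eq with h | h
      · linarith
      · exact absurd ⟨h.symm, by linarith⟩ hz
    rw [hm0, max_eq_left hc, max_eq_left hbc, abs_of_nonneg hb, abs_zero,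
      show b + c - b - 0 = c by ring, abs_of_nonneg hc, add_zero, div_self hne.ne'] at h1
    have : ρ = 1 := by rw [h1]; norm_num
    subst this; subst hm0
    refine ⟨by linarith, by linarith, by linarith, by linarith, by ring, by ring⟩
  · rcases le_or_gt 0 b with hb | hb
    · have hmc : m = c := by rw [hm, min_eq_left hc.le, min_eq_right hbc]
      rw [hmc, max_eq_right hc.le, max_eq_left hb, abs_of_nonneg hb, abs_of_neg hc,
        show b + c - b - c = 0 by ring, abs_zero, add_zero] at h1
      have hd : 0 < b + -c := by linarith
      have e : 1 / 4 + 3 / 4 * ((b + c) / (b + -c)) = (b + c / 2) / (b + -c) := by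
        field_simp; ring
      rw [e] at h1
      subst hmc
      rcases le_total 0 (b + m / 2) with h | h
      · rw [max_eq_left (by positivity)] at h1
        have e2 : ρ * (b - m) = b + m / 2 := by
          rw [h1]; field_simp; ring
        rw [e2]
        refine ⟨by linarith, by simp, by simp; linarith, by simp; linarith, by ring, by ring⟩
      · rw [max_eq_right (div_nonpos_of_nonpos_of_nonneg h hd.le)] at h1
        subst h1
        refine ⟨by simp, by simp, by linarith, by linarith, by ring, by ring⟩
    · have hmc : m = c := by rw [hm, min_eq_left hc.le, min_eq_right hbc]
      rw [hmc, max_eq_right hc.le, max_eq_right hb.le, abs_zero, abs_of_neg hc,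
        show b + c - 0 - c = b by ring, abs_of_neg hb] at h1
      have hne : b + c ≠ 0 := by linarith
      have e : (b + c) / (0 + -b + -c) = -1 := by
        rw [show 0 + -b + -c = -(b + c) by ring, div_neg, div_self hne]
      rw [e] at h1
      have : ρ = 0 := by rw [h1]; norm_num
      subst this
      refine ⟨by simp, by simp, by linarith, by linarith, by ring, by ring⟩

theorem aux_quad (D E : ℝ) (h : ∀ t : ℝ, 0 ≤ t ^ 2 * D + 2 * t * E) : E = 0 := by
  have hs : 0 < 1 + |D| := by positivity
  have h1 := h (-E / (1 + |D|))
  have e : (-E / (1 + |D|)) ^ 2 * D + 2 * (-E / (1 + |D|)) * E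
      = E ^ 2 * (D - 2 * (1 + |D|)) / (1 + |D|) ^ 2 := by
    field_simp
    ring
  rw [e] at h1
  have h2 : 0 ≤ E ^ 2 * (D - 2 * (1 + |D|)) := by
    by_contra hc
    push Not at hc
    exact absurd h1 (not_le.2 (div_neg_of_neg_of_pos hc (by positivity)))
  have h3 := le_abs_self D
  have h5 := mul_nonneg (sq_nonneg E) (sub_nonneg.2 h3)
  have h6 := mul_nonneg (sq_nonneg E) (abs_nonneg D)
  have h4 : E ^ 2 ≤ 0 := by nlinarith
  exact (pow_eq_zero_iff two_ne_zero).1 (le_antisymm h4 (sq_nonneg E))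

theorem aux_rank1 (Q : Mat3) (hQ : Qᵀ * Q = 1) (v : Fin 3 → ℝ) (hv : ∀ i, Q i 2 = v i)
    (l m : ℝ) :
    Q * diagonal ![l, l, l - m] * Qᵀ = l • (1 : Mat3) - m • vecMulVec v v := by
  have h' : Q * Qᵀ = 1 := mul_eq_one_comm.1 hQ
  rw [← h']
  ext i j
  simp [Matrix.mul_apply, Fin.sum_univ_three, vecMulVec_apply, diagonal_apply, ← hv]
  ring

theorem aux_symm_conj (Q M : Mat3) (hM : Mᵀ = M) : (Q * M * Qᵀ).IsSymm := by
  rw [Matrix.IsSymm, transpose_mul, transpose_mul, transpose_transpose, hM, Matrix.mul_assoc]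

theorem aux_memC (k : ℝ) (Q : Mat3) (hQ : Qᵀ * Q = 1) (d e f : ℝ)
    (h : max d (max e f) - min d (min e f) ≤ 2 * k) :
    Q * diagonal ![d, e, f] * Qᵀ ∈ {τ : Mat3 | τ.IsSymm ∧ lam1 τ - lam3 τ ≤ 2 * k} := by
  obtain ⟨h1, h3, -⟩ := aux_lam Q hQ d e f
  refine ⟨aux_symm_conj _ _ (diagonal_transpose _), ?_⟩
  rw [h1, h3]; exact h

theorem aux_minner_diag (W : Mat3) (d e f : ℝ) :
    minner W (diagonal ![d, e, f]) = W 0 0 * d + W 1 1 * e + W 2 2 * f := by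
  simp [minner, Matrix.trace, Fin.sum_univ_three, Matrix.mul_apply, diagonal_apply]

theorem aux_normal_test (k : ℝ) (hk : 0 < k) (C : Set Mat3)
    (hC : C = {τ : Mat3 | τ.IsSymm ∧ lam1 τ - lam3 τ ≤ 2 * k})
    (Q : Mat3) (hQ : Qᵀ * Q = 1) (l : ℝ) (w : Mat3)
    (hw : w ∈ normalCone C (Q * diagonal ![l, l, l - 2 * k] * Qᵀ)) :
    0 ≤ (Qᵀ * w * Q) 0 0 ∧ 0 ≤ (Qᵀ * w * Q) 1 1 ∧
    (Qᵀ * w * Q) 0 0 + (Qᵀ * w * Q) 1 1 + (Qᵀ * w * Q) 2 2 = 0 ∧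
    (Qᵀ * w * Q) 0 2 = 0 ∧ (Qᵀ * w * Q) 1 2 = 0 ∧ (Qᵀ * w * Q)ᵀ = Qᵀ * w * Q := by
  obtain ⟨hws, hw⟩ := hw
  have hWs : (Qᵀ * w * Q)ᵀ = Qᵀ * w * Q := by
    rw [transpose_mul, transpose_mul, hws.eq, transpose_transpose, Matrix.mul_assoc]
  set W := Qᵀ * w * Q with hW
  have test : ∀ M : Mat3, Q * M * Qᵀ ∈ C →
      minner W M ≤ minner W (diagonal ![l, l, l - 2 * k]) := by
    intro M hM
    have h := hw (Q * M * Qᵀ - Q * diagonal ![l, l, l - 2 * k] * Qᵀ)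
      (subset_closure ⟨_, hM, 1, one_pos, by simp⟩)
    rw [← Matrix.sub_mul, ← Matrix.mul_sub, aux_minner_conj, ← hW, minner, Matrix.mul_sub,
      trace_sub] at h
    rw [minner, minner]; linarith
  have dtest : ∀ d e f : ℝ, max d (max e f) - min d (min e f) ≤ 2 * k →
      W 0 0 * d + W 1 1 * e + W 2 2 * f ≤ W 0 0 * l + W 1 1 * l + W 2 2 * (l - 2 * k) := by
    intro d e f h
    have := test (diagonal ![d, e, f]) (hC ▸ aux_memC k Q hQ d e f h)
    rwa [aux_minner_diag, aux_minner_diag] at this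
  have rtest : ∀ y : Fin 3 → ℝ, y ⬝ᵥ y = 1 → W 2 2 ≤ y ⬝ᵥ (W *ᵥ y) := by
    intro y hy
    obtain ⟨T, hT, hTy⟩ := aux_frame y hy
    have hm : Q * (T * diagonal ![l, l, l - 2 * k] * Tᵀ) * Qᵀ ∈ C := by
      have h1 : (Q * T)ᵀ * (Q * T) = 1 := by
        rw [transpose_mul]
        calc Tᵀ * Qᵀ * (Q * T) = Tᵀ * (Qᵀ * Q) * T := by simp only [Matrix.mul_assoc]
          _ = 1 := by rw [hQ, Matrix.mul_one, hT]
      have h2 := aux_memC k (Q * T) h1 l l (l - 2 * k) (by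
        have := max_le (le_refl l) (max_le (le_refl l) (show l - 2 * k ≤ l by linarith))
        have := le_min (show l - 2 * k ≤ l by linarith)
          (le_min (show l - 2 * k ≤ l by linarith) (le_refl (l - 2 * k)))
        linarith)
      rw [hC]
      rw [transpose_mul] at h2
      simpa only [Matrix.mul_assoc] using h2
    have h := test _ hm
    rw [aux_rank1 T hT y hTy, aux_minner_diag] at h
    have e : minner W (l • (1 : Mat3) - (2 * k) • vecMulVec y y)
        = l * (W 0 0 + W 1 1 + W 2 2) - 2 * k * (y ⬝ᵥ (W *ᵥ y)) := by
      simp [minner, Matrix.trace, Fin.sum_univ_three, Matrix.mul_apply, vecMulVec_apply,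
        mulVec, dotProduct, Matrix.one_apply]
      ring
    rw [e] at h
    nlinarith
  have sp : ∀ d e f u L : ℝ, d ≤ u → e ≤ u → f ≤ u → L ≤ d → L ≤ e → L ≤ f → u - L ≤ 2 * k →
      max d (max e f) - min d (min e f) ≤ 2 * k := by
    intro d e f u L h1 h2 h3 h4 h5 h6 h7
    have := max_le h1 (max_le h2 h3)
    have := le_min h4 (le_min h5 h6)
    linarith
  have t1 := dtest (l - 2 * k) l (l - 2 * k) (sp _ _ _ l (l - 2 * k) (by linarith) (by linarith)
    (by linarith) (by linarith) (by linarith) (by linarith) (by linarith))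
  have t2 := dtest l (l - 2 * k) (l - 2 * k) (sp _ _ _ l (l - 2 * k) (by linarith) (by linarith)
    (by linarith) (by linarith) (by linarith) (by linarith) (by linarith))
  have t3 := dtest (l + 1) (l + 1) (l - 2 * k + 1) (sp _ _ _ (l + 1) (l - 2 * k + 1) (by linarith)
    (by linarith) (by linarith) (by linarith) (by linarith) (by linarith) (by linarith))
  have t4 := dtest (l - 1) (l - 1) (l - 2 * k - 1) (sp _ _ _ (l - 1) (l - 2 * k - 1) (by linarith)
    (by linarith) (by linarith) (by linarith) (by linarith) (by linarith) (by linarith))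
  have s20 : W 2 0 = W 0 2 := congrFun (congrFun hWs 0) 2
  have s21 : W 2 1 = W 1 2 := congrFun (congrFun hWs 1) 2
  refine ⟨by nlinarith, by nlinarith, by linarith, ?_, ?_, hWs⟩
  · refine aux_quad (W 0 0 - W 2 2) _ fun t => ?_
    have hp : 0 < 1 + t ^ 2 := by positivity
    have hs := Real.mul_self_sqrt hp.le
    have hs0 := Real.sqrt_pos.2 hp
    set r := Real.sqrt (1 + t ^ 2)
    have h := rtest ![t / r, 0, 1 / r] (by
      simp [dotProduct, Fin.sum_univ_three]; field_simp; nlinarith)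
    have e : ![t / r, 0, 1 / r] ⬝ᵥ (W *ᵥ ![t / r, 0, 1 / r])
        = (t ^ 2 * W 0 0 + 2 * t * W 0 2 + W 2 2) / (r * r) := by
      simp [dotProduct, mulVec, Fin.sum_univ_three, s20]; field_simp; ring
    rw [e, hs, le_div_iff₀ hp] at h
    linarith
  · refine aux_quad (W 1 1 - W 2 2) _ fun t => ?_
    have hp : 0 < 1 + t ^ 2 := by positivity
    have hs := Real.mul_self_sqrt hp.le
    have hs0 := Real.sqrt_pos.2 hp
    set r := Real.sqrt (1 + t ^ 2)
    have h := rtest ![0, t / r, 1 / r] (by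
      simp [dotProduct, Fin.sum_univ_three]; field_simp; nlinarith)
    have e : ![0, t / r, 1 / r] ⬝ᵥ (W *ᵥ ![0, t / r, 1 / r])
        = (t ^ 2 * W 1 1 + 2 * t * W 1 2 + W 2 2) / (r * r) := by
      simp [dotProduct, mulVec, Fin.sum_univ_three, s21]; field_simp; ring
    rw [e, hs, le_div_iff₀ hp] at h
    linarith

theorem aux_normal_mem (k : ℝ) (C : Set Mat3)
    (hC : C = {τ : Mat3 | τ.IsSymm ∧ lam1 τ - lam3 τ ≤ 2 * k})
    (Q : Mat3) (hQ : Qᵀ * Q = 1) (l a b : ℝ) (ha : 0 ≤ a) (hb : 0 ≤ b) :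
    Q * diagonal ![a, b, -(a + b)] * Qᵀ ∈
      normalCone C (Q * diagonal ![l, l, l - 2 * k] * Qᵀ) := by
  refine ⟨aux_symm_conj _ _ (diagonal_transpose _), ?_⟩
  have hcl : IsClosed {τ : Mat3 | minner (Q * diagonal ![a, b, -(a + b)] * Qᵀ) τ ≤ 0} := by
    refine isClosed_le ?_ continuous_const
    unfold minner
    exact Continuous.matrix_trace (continuous_const.matrix_mul continuous_id)
  have hsub : {τ | ∃ η ∈ C, ∃ α : ℝ, 0 < α ∧
      τ = α • (η - Q * diagonal ![l, l, l - 2 * k] * Qᵀ)} ⊆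
      {τ : Mat3 | minner (Q * diagonal ![a, b, -(a + b)] * Qᵀ) τ ≤ 0} := by
    rintro _ ⟨η, hη, α, hα, rfl⟩
    rw [hC] at hη
    obtain ⟨hs, hl⟩ := hη
    have b0 := (aux_bounds η hs Q hQ 0).2
    have b1 := (aux_bounds η hs Q hQ 1).2
    have b2 := (aux_bounds η hs Q hQ 2).1
    have e1 : Qᵀ * (η - Q * diagonal ![l, l, l - 2 * k] * Qᵀ) * Q
        = Qᵀ * η * Q - diagonal ![l, l, l - 2 * k] := by
      rw [Matrix.mul_sub, Matrix.sub_mul]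
      congr 1
      calc Qᵀ * (Q * diagonal ![l, l, l - 2 * k] * Qᵀ) * Q
          = (Qᵀ * Q) * diagonal ![l, l, l - 2 * k] * (Qᵀ * Q) := by simp only [Matrix.mul_assoc]
        _ = _ := by rw [hQ]; simp
    show minner _ _ ≤ 0
    have e2 : minner (Q * diagonal ![a, b, -(a + b)] * Qᵀ)
        (α • (η - Q * diagonal ![l, l, l - 2 * k] * Qᵀ))
        = α * minner (Q * diagonal ![a, b, -(a + b)] * Qᵀ)
          (η - Q * diagonal ![l, l, l - 2 * k] * Qᵀ) := by
      simp [minner]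
    rw [e2, aux_minner_comm, aux_minner_conj, e1, aux_minner_diag]
    refine mul_nonpos_of_nonneg_of_nonpos hα.le ?_
    simp only [Matrix.sub_apply, diagonal_apply_eq]
    simp only [Matrix.cons_val]
    nlinarith [mul_nonneg ha (sub_nonneg.2 (b0.trans (le_refl _))),
      mul_nonneg hb (sub_nonneg.2 b1), mul_nonneg ha (sub_nonneg.2 b2),
      mul_nonneg hb (sub_nonneg.2 b2), mul_nonneg ha (sub_nonneg.2 hl),
      mul_nonneg hb (sub_nonneg.2 hl)]
  intro τ hτ
  exact closure_minimal hsub hcl hτ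

theorem aux_self_nonneg (A : Mat3) (hA : Aᵀ = A) : 0 ≤ minner A A := by
  have : minner A A = (Aᵀ * A).trace := by rw [hA]; rfl
  rw [this]
  simp only [Matrix.trace, Matrix.diag, Matrix.mul_apply, transpose_apply]
  exact Finset.sum_nonneg fun i _ => Finset.sum_nonneg fun j _ => mul_self_nonneg _

theorem aux_orth (G : Set Mat3) (z B g : Mat3) (hz : zᵀ = z) (hB : Bᵀ = B) (hgs : gᵀ = g) (hP : IsProjOn G z B)
    (hg : ∀ t : ℝ, B + t • g ∈ G) : minner (z - B) g = 0 := by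
  have h : ∀ t : ℝ, 0 ≤ t ^ 2 * minner g g + 2 * t * (-minner (z - B) g) := by
    intro t
    have h1 := hP.2 _ (hg t)
    unfold mnorm at h1
    have e : minner (z - (B + t • g)) (z - (B + t • g))
        = minner (z - B) (z - B) + (t ^ 2 * minner g g + 2 * t * (-minner (z - B) g)) := by
      have c : minner g (z - B) = minner (z - B) g := aux_minner_comm _ _
      have : z - (B + t • g) = (z - B) - t • g := by abel
      rw [this]
      generalize z - B = Y at *
      unfold minner at *
      simp only [Matrix.sub_mul, Matrix.mul_sub, trace_sub, Matrix.smul_mul, Matrix.mul_smul,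
        trace_smul, smul_eq_mul, c]
      ring
    have h2 : 0 ≤ minner (z - (B + t • g)) (z - (B + t • g)) :=
      aux_self_nonneg _ (by rw [transpose_sub, transpose_add, transpose_smul, hz, hB, hgs])
    rw [Real.sqrt_le_sqrt_iff h2, e] at h1
    linarith
  linarith [aux_quad _ _ h]

/-- Projection onto the normal cone of the Tresca domain at a boundary point with a double
largest eigenvalue: with `B = P_{G₃(σ)}(dev τ)`, `S₃ = B - λ₃(B) I` and the factor `ρ₃`,
one has `P_{N_{C_T}(σ)}(τ) = ρ₃ (S₃ - tr(S₃) v₃v₃ᵀ)`. -/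
theorem stmt18 (k : ℝ) (hk : 0 < k)
    (C : Set Mat3) (hC : C = {τ : Mat3 | τ.IsSymm ∧ lam1 τ - lam3 τ ≤ 2 * k})
    (σ : Mat3) (hσsym : σ.IsSymm)
    (h12 : lam1 σ = lam2 σ) (h23 : lam3 σ < lam2 σ) (hσbd : lam1 σ - lam3 σ = 2 * k)
    (v₃ : Fin 3 → ℝ) (hv₃ : σ *ᵥ v₃ = lam3 σ • v₃) (hv₃u : v₃ ⬝ᵥ v₃ = 1)
    (G₃ : Set Mat3) (hG₃ : G₃ = {τ : Mat3 | τ.IsSymm ∧ τ *ᵥ v₃ = 0}) :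
    ∀ τ B : Mat3, τ.IsSymm → IsProjOn G₃ (dev τ) B →
      ∀ S : Mat3, S = B - lam3 B • (1 : Mat3) →
      ∀ ρ : ℝ, (B = 0 → ρ = 0) →
        (B ≠ 0 → ρ = max (1 / 4 + 3 / 4 *
          ((lam1 B + lam2 B + lam3 B) / (|lam1 B| + |lam2 B| + |lam3 B|))) 0) →
        IsProjOn (normalCone C σ) τ (ρ • (S - S.trace • vecMulVec v₃ v₃)) := by
  intro τ B hτ hP S hS ρ hρ0 hρ1
  -- structure of `B`
  have hBG := hP.1
  rw [hG₃] at hBG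
  obtain ⟨hBs, hBv⟩ := hBG
  obtain ⟨Q, hQ, hQv, b, c, hcb, hBQ⟩ := aux_spec B hBs v₃ hv₃u 0 (by simpa using hBv)
  have hQ' : Q * Qᵀ = 1 := mul_eq_one_comm.1 hQ
  obtain ⟨hB1, hB3, hBt⟩ := aux_lam Q hQ b c 0
  rw [← hBQ] at hB1 hB3 hBt
  -- structure of `σ`
  have hσQ : σ = Q * diagonal ![lam1 σ, lam1 σ, lam1 σ - 2 * k] * Qᵀ := by
    obtain ⟨R, hR, hRv, d, e, -, hσR⟩ := aux_spec σ hσsym v₃ hv₃u (lam3 σ) hv₃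
    obtain ⟨h1, h3, ht⟩ := aux_lam R hR d e (lam3 σ)
    rw [← hσR] at h1 ht
    have hd : d ≤ lam1 σ := by rw [h1]; exact le_max_left _ _
    have he : e ≤ lam1 σ := by
      rw [h1]; exact (le_max_left _ _).trans (le_max_right _ _)
    have h2 : lam2 σ = d + e - lam1 σ := by rw [lam2, ht]; ring
    have hd' : d = lam1 σ := by linarith
    have he' : e = lam1 σ := by linarith
    have hl3 : lam3 σ = lam1 σ - 2 * k := by linarith
    rw [aux_rank1 Q hQ v₃ hQv, ← aux_rank1 R hR v₃ hRv]
    rw [hl3, hd', he'] at hσR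
    exact hσR
  set l := lam1 σ with hl
  -- the candidate
  set m := lam3 B with hm
  have hp : ρ • (S - S.trace • vecMulVec v₃ v₃) =
      Q * diagonal ![ρ * (b - m), ρ * (c - m), -(ρ * (b - m) + ρ * (c - m))] * Qᵀ := by
    have hSt : S.trace = b + c - 3 * m := by
      rw [hS, trace_sub, hBt, trace_smul, trace_one]; simp; ring
    have hS' : S = Q * diagonal ![b - m, c - m, -m] * Qᵀ := by
      have h2 : diagonal ![b - m, c - m, -m] = diagonal ![b, c, 0] - m • (1 : Mat3) := by
        ext i j
        fin_cases i <;> fin_cases j <;> simp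
      rw [h2, Matrix.mul_sub, Matrix.sub_mul, ← hBQ, hS]
      simp [hQ']
    rw [hSt, hS']
    ext i j
    simp [Matrix.mul_apply, Fin.sum_univ_three, vecMulVec_apply, diagonal_apply, ← hQv]
    ring
  obtain ⟨ha, hc, k1, k2, k3, k4⟩ := aux_scalar b c ρ m hcb hB3
    (fun h1 h2 => hρ0 (by
      rw [hBQ, h1, h2]
      ext i j
      simp [Matrix.mul_apply, Fin.sum_univ_three, diagonal_apply]))
    (fun h => by
      have hne : B ≠ 0 := by
        intro h0
        have hz : diagonal ![b, c, 0] = (0 : Mat3) := by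
          have h3 : Qᵀ * B * Q = diagonal ![b, c, 0] := by
            rw [hBQ]
            calc Qᵀ * (Q * diagonal ![b, c, 0] * Qᵀ) * Q
                = (Qᵀ * Q) * diagonal ![b, c, 0] * (Qᵀ * Q) := by simp only [Matrix.mul_assoc]
              _ = _ := by rw [hQ]; simp
          rw [← h3, h0]; simp
        exact h ⟨by simpa using congrFun (congrFun hz 0) 0,
          by simpa using congrFun (congrFun hz 1) 1⟩
      have h2 : lam2 B = b + c - max b (max c 0) - m := by rw [lam2, hBt, hB1, add_zero]
      rw [hρ1 hne, h2, hB1]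
      congr 4
      ring)
  rw [hp]
  set a₁ := ρ * (b - m) with ha₁
  set a₂ := ρ * (c - m) with ha₂
  clear_value a₁ a₂
  set p := Q * diagonal ![a₁, a₂, -(a₁ + a₂)] * Qᵀ with hpdef
  have hpN : p ∈ normalCone C σ := by
    rw [hσQ]; exact aux_normal_mem k C hC Q hQ l a₁ a₂ ha hc
  refine ⟨hpN, fun w hw => ?_⟩
  have hws := hw.1
  rw [hσQ] at hw
  obtain ⟨w0, w1, w2, w02, w12, wS⟩ := aux_normal_test k hk C hC Q hQ l w hw
  -- coordinates of `τ`
  set t := Qᵀ * τ * Q with htdef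
  have htr : τ.trace = t 0 0 + t 1 1 + t 2 2 := by
    have : t.trace = τ.trace := by
      rw [htdef, trace_mul_comm, ← Matrix.mul_assoc, hQ', Matrix.one_mul]
    rw [← this]; simp [Matrix.trace, Fin.sum_univ_three]
  have hdev : Qᵀ * (dev τ - B) * Q = t - (τ.trace / 3) • (1 : Mat3) - diagonal ![b, c, 0] := by
    have h3 : Qᵀ * B * Q = diagonal ![b, c, 0] := by
      rw [hBQ]
      calc Qᵀ * (Q * diagonal ![b, c, 0] * Qᵀ) * Q
          = (Qᵀ * Q) * diagonal ![b, c, 0] * (Qᵀ * Q) := by simp only [Matrix.mul_assoc]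
        _ = _ := by rw [hQ]; simp
    rw [dev, Matrix.mul_sub, Matrix.sub_mul, h3, Matrix.mul_sub, Matrix.sub_mul]
    simp [hQ, htdef]
  have hdevs : (dev τ)ᵀ = dev τ := by
    rw [dev, transpose_sub, hτ.eq, transpose_smul, transpose_one]
  have horth : ∀ E : Mat3, Eᵀ = E → (∀ i, E i 2 = 0) →
      minner (t - (τ.trace / 3) • (1 : Mat3) - diagonal ![b, c, 0]) E = 0 := by
    intro E hE hE2
    rw [← hdev, ← aux_minner_conj]
    have hgs : (Q * E * Qᵀ).IsSymm := aux_symm_conj Q E hE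
    refine aux_orth G₃ (dev τ) B _ hdevs hBs hgs hP fun s => ?_
    rw [hG₃]
    refine ⟨hBs.add (hgs.smul s), ?_⟩
    have hQTv : Qᵀ *ᵥ v₃ = ![0, 0, 1] := by
      ext i
      have h := congrFun (congrFun hQ i) 2
      simp only [Matrix.mul_apply, hQv] at h
      simp only [mulVec, dotProduct]
      rw [h]
      fin_cases i
      · simp
      · simp
      · exact one_apply_eq (2 : Fin 3)
    have hEv : E *ᵥ ![0, 0, 1] = 0 := by
      ext i
      simp [mulVec, dotProduct, Fin.sum_univ_three, hE2]
    rw [Matrix.add_mulVec, hBv, Matrix.smul_mulVec, ← Matrix.mulVec_mulVec,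
      ← Matrix.mulVec_mulVec, hQTv, hEv]
    simp
  have o0 := horth (diagonal ![1, 0, 0]) (diagonal_transpose _)
    (by intro i; fin_cases i <;> simp)
  have o1 := horth (diagonal ![0, 1, 0]) (diagonal_transpose _)
    (by intro i; fin_cases i <;> simp)
  have o01 := horth !![0, 1, 0; 1, 0, 0; 0, 0, 0]
    (by ext i j; fin_cases i <;> fin_cases j <;> simp)
    (by intro i; fin_cases i <;> simp)
  rw [aux_minner_diag] at o0 o1
  have hts : tᵀ = t := by
    rw [htdef, transpose_mul, transpose_mul, hτ.eq, transpose_transpose, Matrix.mul_assoc]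
  have t10 : t 1 0 = t 0 1 := congrFun (congrFun hts 0) 1
  have t20 : t 2 0 = t 0 2 := congrFun (congrFun hts 0) 2
  have t21 : t 2 1 = t 1 2 := congrFun (congrFun hts 1) 2
  simp [minner, Matrix.trace, Fin.sum_univ_three, Matrix.mul_apply, diagonal_apply, t10] at o01
  simp at o0 o1
  have t01 : t 0 1 = 0 := by linarith
  -- variational inequality
  have hconjp : Qᵀ * (τ - p) * Q = t - diagonal ![a₁, a₂, -(a₁ + a₂)] := by
    rw [Matrix.mul_sub, Matrix.sub_mul]
    congr 1
    calc Qᵀ * (Q * diagonal ![a₁, a₂, -(a₁ + a₂)] * Qᵀ) * Q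
        = (Qᵀ * Q) * diagonal ![a₁, a₂, -(a₁ + a₂)] * (Qᵀ * Q) := by simp only [Matrix.mul_assoc]
      _ = _ := by rw [hQ]; simp
  have v1 : minner (τ - p) p = 0 := by
    rw [hpdef, aux_minner_conj, ← hpdef, hconjp, aux_minner_diag]
    simp
    linear_combination k3 + k4 + (2 * a₁ + a₂) * o0 + (a₁ + 2 * a₂) * o1 + (a₁ + a₂) * htr
  have v2 : minner (τ - p) w ≤ 0 := by
    rw [← aux_conj Q w hQ, aux_minner_conj, hconjp]
    set W := Qᵀ * w * Q
    have s20 : W 2 0 = 0 := by rw [← w02]; exact congrFun (congrFun wS 0) 2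
    have s21 : W 2 1 = 0 := by rw [← w12]; exact congrFun (congrFun wS 1) 2
    have e : minner (t - diagonal ![a₁, a₂, -(a₁ + a₂)]) W
        = (t 0 0 - a₁) * W 0 0 + (t 1 1 - a₂) * W 1 1 + (t 2 2 + (a₁ + a₂)) * W 2 2 := by
      simp [minner, Matrix.trace, Fin.sum_univ_three, Matrix.mul_apply, diagonal_apply, t10, t01,
        s20, s21, w02, w12]
      left
      ring
    have hW2 : W 2 2 = -(W 0 0 + W 1 1) := by linarith
    have e2 : (t 0 0 - a₁) * W 0 0 + (t 1 1 - a₂) * W 1 1 + (t 2 2 + (a₁ + a₂)) * W 2 2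
        = (2 * b + c - 2 * a₁ - a₂) * W 0 0 + (b + 2 * c - a₁ - 2 * a₂) * W 1 1 := by
      rw [hW2]
      linear_combination (2 * W 0 0 + W 1 1) * o0 + (W 0 0 + 2 * W 1 1) * o1
        + (W 0 0 + W 1 1) * htr
    rw [e, e2]
    exact add_nonpos (mul_nonpos_of_nonpos_of_nonneg k1 w0) (mul_nonpos_of_nonpos_of_nonneg k2 w1)
  have hps := hpN.1
  have v3 : 0 ≤ minner (p - w) (p - w) := aux_self_nonneg _ (by rw [transpose_sub, hps.eq, hws.eq])
  unfold mnorm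
  refine Real.sqrt_le_sqrt ?_
  have e : minner (τ - w) (τ - w)
      = minner (τ - p) (τ - p) + 2 * (minner (τ - p) p - minner (τ - p) w)
        + minner (p - w) (p - w) := by
    have e1 : τ - w = (τ - p) + (p - w) := by abel
    rw [e1]
    have c1 : minner p (τ - p) = minner (τ - p) p := aux_minner_comm _ _
    have c2 : minner w (τ - p) = minner (τ - p) w := aux_minner_comm _ _
    generalize τ - p = Y at *
    unfold minner at *
    simp only [Matrix.add_mul, Matrix.mul_add, Matrix.sub_mul, Matrix.mul_sub, trace_sub,
      trace_add, c1, c2]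
    ring
  rw [e]
  linarith
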